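/- Let m ≥ 1. In the ring ℤ[s,s⁻¹] of Laurent polynomials, with z = s − s⁻¹, the following identity holds: Σ_{c ⊨ m} (∏_{j} c_j) · z^{2(ℓ(c)−1)} = Σ_{a=0}^{m−1} s^{2(2a−(m−1))}, where the sum on the left is over all compositions c = (c₁,…,c_ℓ) of m, ∏_j c_j is the product of the parts of c, and ℓ(c) is the number of parts of c. -/

import Mathlib

open LaurentPolynomial Finset

def consComp (n : ℕ) (x : Σ j : Fin (n + 1), Composition (j : ℕ)) : Composition (n + 1) where
  blocks := (n + 1 - (x.1 : ℕ)) :: x.2.blocks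
  blocks_pos := by
    intro i hi
    rcases List.mem_cons.1 hi with h | h
    · have := x.1.2
      omega
    · exact x.2.blocks_pos h
  blocks_sum := by
    have := x.1.2
    rw [List.sum_cons, x.2.blocks_sum]
    omega

theorem consComp_bij (n : ℕ) : Function.Bijective (consComp n) := by
  constructor
  · rintro ⟨⟨j, hj⟩, c⟩ ⟨⟨k, hk⟩, d⟩ h
    have h1 : c.blocks = d.blocks := by
      have := congrArg (fun c => c.blocks.tail) h
      simpa [consComp] using this
    have h2 : j = k := by
      exact c.blocks_sum.symm.trans ((congrArg List.sum h1).trans d.blocks_sum)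
    subst h2
    have : c = d := Composition.ext h1
    subst this
    rfl
  · intro c
    rcases hb : c.blocks with _ | ⟨a, l⟩
    · have := c.blocks_sum
      simp [hb] at this
    · have hs := c.blocks_sum
      rw [hb, List.sum_cons] at hs
      have ha : 0 < a := c.blocks_pos (by rw [hb]; simp)
      refine ⟨⟨⟨l.sum, by omega⟩, ⟨l, fun {i} hi => c.blocks_pos (by rw [hb]; simp [hi]), rfl⟩⟩, ?_⟩
      apply Composition.ext
      simp only [consComp, hb]
      congr 1
      omega

noncomputable def FF {R : Type*} [CommRing R] (w : R) (n : ℕ) : R :=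
  ∑ c : Composition n, ((c.blocks.prod : ℕ) : R) * w ^ c.length

theorem FF_zero {R : Type*} [CommRing R] (w : R) : FF w 0 = 1 := by
  have h : ∀ c : Composition 0, ((c.blocks.prod : ℕ) : R) * w ^ c.length = 1 := by
    intro c
    have : c.blocks = [] := c.blocks_eq_nil.2 rfl
    simp [Composition.length, this]
  rw [FF, Finset.sum_congr rfl (fun c _ => h c)]
  simp [composition_card]

theorem FF_succ {R : Type*} [CommRing R] (w : R) (n : ℕ) :
    FF w (n + 1) = w * ∑ j ∈ range (n + 1), ((n : R) + 1 - j) * FF w j := by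
  rw [FF, ← (consComp_bij n).sum_comp, Fintype.sum_sigma, Finset.sum_range, Finset.mul_sum]
  refine Finset.sum_congr rfl fun j _ => ?_
  rw [FF, Finset.mul_sum, Finset.mul_sum]
  refine Finset.sum_congr rfl fun c _ => ?_
  have := j.2
  simp only [consComp, Composition.length, List.prod_cons, List.length_cons]
  rw [Nat.cast_mul, Nat.cast_sub (by omega)]
  push_cast
  ring

theorem FF_diff {R : Type*} [CommRing R] (w : R) (n : ℕ) :
    FF w (n + 2) - FF w (n + 1) = w * ∑ j ∈ range (n + 2), FF w j := by
  rw [FF_succ w (n + 1), FF_succ w n, ← mul_sub, Finset.sum_range_succ,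
    Finset.sum_range_succ _ (n + 1), add_sub_right_comm, ← Finset.sum_sub_distrib]
  congr 2
  · refine Finset.sum_congr rfl fun j _ => ?_
    push_cast
    ring
  · push_cast
    ring

theorem FF_rec {R : Type*} [CommRing R] (w : R) (n : ℕ) :
    FF w (n + 3) = (w + 2) * FF w (n + 2) - FF w (n + 1) := by
  have h1 := FF_diff w n
  have h2 := FF_diff w (n + 1)
  rw [Finset.sum_range_succ] at h2
  linear_combination h2 - h1

noncomputable def UU (m : ℕ) : LaurentPolynomial ℤ :=
  ∑ a ∈ Finset.range m, T (2 * (2 * (a : ℤ) - ((m : ℤ) - 1)))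

theorem UU_top (m : ℕ) : UU (m + 1) = T (-2) * UU m + T (2 * m) := by
  rw [UU, Finset.sum_range_succ, UU, Finset.mul_sum]
  congr 1
  · refine Finset.sum_congr rfl fun j _ => ?_
    rw [← T_add]
    congr 1
    push_cast
    ring
  · congr 1
    push_cast
    ring

theorem T_two_mul_neg : (T 2 * T (-2) : LaurentPolynomial ℤ) = 1 := by
  rw [← T_add]; simp

theorem UU_rec (m : ℕ) : UU (m + 2) = (T 2 + T (-2)) * UU (m + 1) - UU m := by
  have h1 := UU_top m
  have h2 := UU_top (m + 1)
  have h3 : (T (2 * ((m + 1 : ℕ) : ℤ)) : LaurentPolynomial ℤ) = T 2 * T (2 * m) := by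
    rw [← T_add]; congr 1; push_cast; ring
  rw [h3] at h2
  linear_combination h2 - T 2 * h1 - UU m * T_two_mul_neg

theorem w_eq : ((T 1 - T (-1)) ^ 2 : LaurentPolynomial ℤ) = T 2 + T (-2) - 2 := by
  have h1 : (T 2 : LaurentPolynomial ℤ) = T 1 * T 1 := by rw [← T_add]; rfl
  have h2 : (T (-2) : LaurentPolynomial ℤ) = T (-1) * T (-1) := by rw [← T_add]; rfl
  have h3 : (T 1 * T (-1) : LaurentPolynomial ℤ) = 1 := by rw [← T_add]; simp
  rw [h1, h2]
  linear_combination -2 * h3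

theorem w_ne : ((T 1 - T (-1)) ^ 2 : LaurentPolynomial ℤ) ≠ 0 := by
  apply pow_ne_zero
  rw [sub_ne_zero]
  intro h
  have := congrArg (fun p : LaurentPolynomial ℤ => p.degree) h
  simp at this

theorem FF_eq (n : ℕ) : FF ((T 1 - T (-1)) ^ 2 : LaurentPolynomial ℤ) (n + 1) =
    (T 1 - T (-1)) ^ 2 * UU (n + 1) ∧
    FF ((T 1 - T (-1)) ^ 2 : LaurentPolynomial ℤ) (n + 2) =
    (T 1 - T (-1)) ^ 2 * UU (n + 2) := by
  induction n with
  | zero =>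
    have u0 : UU 0 = 0 := by simp [UU]
    have u1 : UU 1 = 1 := by simp [UU]
    have f1 := FF_succ ((T 1 - T (-1)) ^ 2 : LaurentPolynomial ℤ) 0
    have f2 := FF_succ ((T 1 - T (-1)) ^ 2 : LaurentPolynomial ℤ) 1
    simp only [Finset.sum_range_succ, Finset.sum_range_zero, FF_zero] at f1 f2
    norm_num at f1 f2
    have u2 := UU_rec 0
    norm_num [u0, u1] at u2
    refine ⟨by norm_num [u1, f1], ?_⟩
    norm_num [u2]
    rw [f2, f1, w_eq]
    ring
  | succ n ih =>
    refine ⟨ih.2, ?_⟩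
    have h := FF_rec ((T 1 - T (-1)) ^ 2 : LaurentPolynomial ℤ) n
    rw [ih.1, ih.2] at h
    have h2 := UU_rec (n + 1)
    have h3 : (T 2 + T (-2) : LaurentPolynomial ℤ) = (T 1 - T (-1)) ^ 2 + 2 := by rw [w_eq]; ring
    rw [h3] at h2
    linear_combination h - (T 1 - T (-1)) ^ 2 * h2

/-- For `m ≥ 1`, in `ℤ[s,s⁻¹]` with `z = s - s⁻¹`,
`Σ_{c ⊨ m} (∏_j c_j) · z^{2(ℓ(c)-1)} = Σ_{a=0}^{m-1} s^{2(2a-(m-1))}`,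
the left sum running over all compositions `c` of `m`. -/
theorem composition_sum_eq_inner_product (m : ℕ) (hm : 1 ≤ m) :
    ∑ c : Composition m,
      ((c.blocks.prod : ℕ) : LaurentPolynomial ℤ) *
        (T 1 - T (-1)) ^ (2 * (c.length - 1)) =
    ∑ a ∈ Finset.range m, T (2 * (2 * (a : ℤ) - ((m : ℤ) - 1))) := by
  obtain ⟨n, rfl⟩ : ∃ n, m = n + 1 := ⟨m - 1, by omega⟩
  apply mul_left_cancel₀ w_ne
  refine Eq.trans ?_ (FF_eq n).1
  rw [FF, Finset.mul_sum]
  refine Finset.sum_congr rfl fun c _ => ?_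
  have hl : 0 < c.length := c.length_pos_iff.2 (by omega)
  obtain ⟨k, hk⟩ : ∃ k, c.length = k + 1 := ⟨c.length - 1, by omega⟩
  rw [hk, Nat.add_sub_cancel, pow_mul, pow_succ]
  ring
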